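/- arXiv:2006.05945 — 4 statements merged into one kernel-verified Lean document; each statement's English description precedes it below -/
import Mathlib

section
/- Let M be a positive semidefinite real p×p matrix and let x_i, x_j, x_l ∈ ℝᵖ. Set v = x_l − x_j, m = (x_j + x_l)/2, and assume c := vᵀ M² v ≠ 0. Let x_min = x_i + (((m − x_i)ᵀ M v)/c) · (M v) be the support point. Then the squared adversarial margin satisfies ‖x_i − x_min‖₂² = (d²_M(x_i, x_l) − d²_M(x_i, x_j))² / (4 · vᵀ M² v). -/
open Matrix

theorem Matrix.IsSymm.dotProduct_mulVec_comm {n R : Type*} [Fintype n] [CommSemiring R]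
    {M : Matrix n n R} (hM : M.IsSymm) (x y : n → R) :
    x ⬝ᵥ (M *ᵥ y) = y ⬝ᵥ (M *ᵥ x) := by
  rw [dotProduct_mulVec, ← mulVec_transpose, hM.eq, dotProduct_comm]

theorem Matrix.IsSymm.dotProduct_mulVec_self_sub {n R : Type*} [Fintype n] [CommRing R]
    {M : Matrix n n R} (hM : M.IsSymm) (x y : n → R) :
    x ⬝ᵥ (M *ᵥ x) - y ⬝ᵥ (M *ᵥ y) = (x + y) ⬝ᵥ (M *ᵥ (x - y)) := by
  rw [mulVec_sub, dotProduct_sub, add_dotProduct, add_dotProduct,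
    hM.dotProduct_mulVec_comm y x]
  ring

theorem Matrix.IsSymm.mulVec_dotProduct_mulVec {n R : Type*} [Fintype n] [CommSemiring R]
    {M : Matrix n n R} (hM : M.IsSymm) (x y : n → R) :
    (M *ᵥ x) ⬝ᵥ (M *ᵥ y) = x ⬝ᵥ ((M * M) *ᵥ y) := by
  rw [← mulVec_mulVec, hM.dotProduct_mulVec_comm x (M *ᵥ y), dotProduct_comm]

/-- The squared adversarial margin: `‖x_i − x_min‖₂² = (d²_M(x_i,x_l) − d²_M(x_i,x_j))² / (4 vᵀ M² v)`. -/
theorem squared_adversarial_margin_formula {p : ℕ}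
    (M : Matrix (Fin p) (Fin p) ℝ) (hM : M.PosSemidef)
    (xi xj xl : Fin p → ℝ)
    (v m : Fin p → ℝ) (hv : v = xl - xj) (hm : m = (xj + xl) / 2)
    (c : ℝ) (hc : c = v ⬝ᵥ ((M * M) *ᵥ v)) (hc0 : c ≠ 0)
    (xmin : Fin p → ℝ)
    (hxmin : xmin = xi + (((m - xi) ⬝ᵥ (M *ᵥ v)) / c) • (M *ᵥ v)) :
    (xi - xmin) ⬝ᵥ (xi - xmin) =
      ((xi - xl) ⬝ᵥ (M *ᵥ (xi - xl)) - (xi - xj) ⬝ᵥ (M *ᵥ (xi - xj))) ^ 2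
        / (4 * (v ⬝ᵥ ((M * M) *ᵥ v))) := by
  have hS : M.IsSymm := isHermitian_iff_isSymm.mp hM.isHermitian
  have hsum : (xi - xl) + (xi - xj) = (-2 : ℝ) • (m - xi) := by
    ext k
    simp [hm]
    ring
  have hdiff : (xi - xl) - (xi - xj) = -v := by
    rw [hv]
    abel
  have hstep : xi - xmin = -((((m - xi) ⬝ᵥ (M *ᵥ v)) / c) • (M *ᵥ v)) := by
    rw [hxmin]
    abel
  rw [hS.dotProduct_mulVec_self_sub, hsum, hdiff, hstep, neg_dotProduct_neg, mulVec_neg, dotProduct_neg,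
    smul_dotProduct, smul_dotProduct, dotProduct_smul,
    hS.mulVec_dotProduct_mulVec, ← hc]
  simp only [smul_eq_mul]
  field_simp
  ring
end

section
/- Let M be a positive semidefinite real p×p matrix, let A₀ be a positive definite real p×p matrix, and let x_i, x_j, x_l ∈ ℝᵖ. Set v = x_l − x_j, m = (x_j + x_l)/2, and assume c := vᵀ M A₀⁻¹ M v ≠ 0. Define x_min = x_i + (((m − x_i)ᵀ M v)/c) · (A₀⁻¹ M v). Then x_min satisfies the constraint (x_min − m)ᵀ M v = 0, and for every x' ∈ ℝᵖ with (x' − m)ᵀ M v = 0 one has (x_min − x_i)ᵀ A₀ (x_min − x_i) ≤ (x' − x_i)ᵀ A₀ (x' − x_i). -/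
open Matrix

/-- If `A` is positive semidefinite and `e` is orthogonal to `A u`, then adding `e` to a multiple
of `u` does not decrease the quadratic form of `A`. -/
lemma Matrix.PosSemidef.quadratic_smul_le_of_dotProduct_eq_zero {n : Type*} [Fintype n]
    {A : Matrix n n ℝ} (hA : A.PosSemidef) {u e : n → ℝ} (h : e ⬝ᵥ (A *ᵥ u) = 0) (t : ℝ) :
    (t • u) ⬝ᵥ (A *ᵥ (t • u)) ≤ (t • u + e) ⬝ᵥ (A *ᵥ (t • u + e)) := by
  have hsymm : Aᵀ = A := by simpa using hA.isHermitian.eq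
  have h' : u ⬝ᵥ (A *ᵥ e) = 0 := by
    rw [dotProduct_mulVec, ← mulVec_transpose, hsymm, dotProduct_comm, h]
  have he : 0 ≤ e ⬝ᵥ (A *ᵥ e) := by simpa using hA.dotProduct_mulVec_nonneg e
  simp only [mulVec_add, mulVec_smul, add_dotProduct, dotProduct_add, smul_dotProduct,
    dotProduct_smul, h, h', smul_zero, add_zero, zero_add]
  linarith

/-- Hyperellipsoid case: with `A₀` positive definite and `c = vᵀ M A₀⁻¹ M v ≠ 0`,
the point `x_min = x_i + (((m − x_i)ᵀ M v)/c)·(A₀⁻¹ M v)` lies on the decision boundary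
`(x' − m)ᵀ M v = 0` and minimizes the ellipsoidal distance `(x' − x_i)ᵀ A₀ (x' − x_i)` over it. -/
theorem ellipsoidal_support_point_on_boundary_and_minimizes {p : ℕ}
    (M : Matrix (Fin p) (Fin p) ℝ) (hM : M.PosSemidef)
    (A₀ : Matrix (Fin p) (Fin p) ℝ) (hA₀ : A₀.PosDef)
    (xi xj xl : Fin p → ℝ)
    (v m : Fin p → ℝ) (hv : v = xl - xj) (hm : m = (xj + xl) / 2)
    (c : ℝ) (hc : c = v ⬝ᵥ ((M * A₀⁻¹ * M) *ᵥ v)) (hc0 : c ≠ 0)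
    (xmin : Fin p → ℝ)
    (hxmin : xmin = xi + (((m - xi) ⬝ᵥ (M *ᵥ v)) / c) • (A₀⁻¹ *ᵥ (M *ᵥ v))) :
    (xmin - m) ⬝ᵥ (M *ᵥ v) = 0 ∧
      ∀ x' : Fin p → ℝ, (x' - m) ⬝ᵥ (M *ᵥ v) = 0 →
        (xmin - xi) ⬝ᵥ (A₀ *ᵥ (xmin - xi)) ≤ (x' - xi) ⬝ᵥ (A₀ *ᵥ (x' - xi)) := by
  have hMt : Mᵀ = M := by simpa using hM.isHermitian.eq
  have hcu : (A₀⁻¹ *ᵥ (M *ᵥ v)) ⬝ᵥ (M *ᵥ v) = c := by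
    rw [hc, Matrix.mul_assoc, ← mulVec_mulVec, ← mulVec_mulVec, dotProduct_mulVec v M,
      ← mulVec_transpose, hMt, dotProduct_comm]
  have hAu : A₀ *ᵥ (A₀⁻¹ *ᵥ (M *ᵥ v)) = M *ᵥ v := by
    rw [mulVec_mulVec, Matrix.mul_nonsing_inv _ ((isUnit_iff_isUnit_det A₀).1 hA₀.isUnit),
      one_mulVec]
  have hmem : (xmin - m) ⬝ᵥ (M *ᵥ v) = 0 := by
    rw [hxmin, sub_dotProduct, add_dotProduct, smul_dotProduct, hcu, smul_eq_mul,
      div_mul_cancel₀ _ hc0, sub_dotProduct]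
    ring
  refine ⟨hmem, fun x' hx' => ?_⟩
  have horth : (x' - xmin) ⬝ᵥ (A₀ *ᵥ (A₀⁻¹ *ᵥ (M *ᵥ v))) = 0 := by
    rw [hAu, ← sub_sub_sub_cancel_right x' xmin m, sub_dotProduct, hx', hmem, sub_zero]
  have key := hA₀.posSemidef.quadratic_smul_le_of_dotProduct_eq_zero horth
    (((m - xi) ⬝ᵥ (M *ᵥ v)) / c)
  rwa [← sub_eq_of_eq_add' hxmin, sub_add_sub_cancel'] at key
end

section
/- Let D be a real d×p matrix (a linear dimensionality-reduction map), M a positive semidefinite real d×d matrix, and A₀ a positive definite real p×p matrix. Let x_i, x_j, x_l ∈ ℝᵖ and write x̃ = D x for each of them. Set ṽ = x̃_l − x̃_j, m̃ = (x̃_j + x̃_l)/2, and assume c := ṽᵀ M D A₀⁻¹ Dᵀ M ṽ ≠ 0. Define x_min^PCA = x_i + (((m̃ − x̃_i)ᵀ M ṽ)/c) · (A₀⁻¹ Dᵀ M ṽ). Then x_min^PCA satisfies the constraint (D x_min^PCA − m̃)ᵀ M ṽ = 0, and for every x' ∈ ℝᵖ with (D x' − m̃)ᵀ M ṽ = 0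 one has (x_min^PCA − x_i)ᵀ A₀ (x_min^PCA − x_i) ≤ (x' − x_i)ᵀ A₀ (x' − x_i). -/
open Matrix

/-- A positive semidefinite quadratic form takes at `u` its minimum over the vectors `z` with
`zᵀ A u = uᵀ A u`. -/
theorem Matrix.PosSemidef.dotProduct_mulVec_le_of_eq {n : Type*} [Fintype n]
    {A : Matrix n n ℝ} (hA : A.PosSemidef) {u z : n → ℝ} (h : z ⬝ᵥ (A *ᵥ u) = u ⬝ᵥ (A *ᵥ u)) :
    u ⬝ᵥ (A *ᵥ u) ≤ z ⬝ᵥ (A *ᵥ z) := by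
  have hpos : 0 ≤ (z - u) ⬝ᵥ (A *ᵥ (z - u)) := by
    simpa using hA.dotProduct_mulVec_nonneg (z - u)
  have hT : Aᵀ = A := by simpa using hA.isHermitian.eq
  have hsymm : u ⬝ᵥ (A *ᵥ z) = z ⬝ᵥ (A *ᵥ u) := by
    rw [dotProduct_mulVec, ← mulVec_transpose, hT, dotProduct_comm]
  simp only [mulVec_sub, sub_dotProduct, dotProduct_sub] at hpos
  linarith

/-- Dimensionality-reduction (PCA) case: with `x̃ = D x`, `ṽ = x̃_l − x̃_j`,
`m̃ = (x̃_j + x̃_l)/2`, and `c = ṽᵀ M D A₀⁻¹ Dᵀ M ṽ ≠ 0`, the point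
`x_min^PCA = x_i + (((m̃ − x̃_i)ᵀ M ṽ)/c)·(A₀⁻¹ Dᵀ M ṽ)` satisfies the boundary constraint
`(D x' − m̃)ᵀ M ṽ = 0` and minimizes the ellipsoidal distance `(x' − x_i)ᵀ A₀ (x' − x_i)`
over the constraint set in the original p-dimensional space. -/
theorem pca_support_point_on_boundary_and_minimizes {d p : ℕ}
    (D : Matrix (Fin d) (Fin p) ℝ)
    (M : Matrix (Fin d) (Fin d) ℝ) (hM : M.PosSemidef)
    (A₀ : Matrix (Fin p) (Fin p) ℝ) (hA₀ : A₀.PosDef)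
    (xi xj xl : Fin p → ℝ)
    (xti xtj xtl : Fin d → ℝ)
    (hxti : xti = D *ᵥ xi) (hxtj : xtj = D *ᵥ xj) (hxtl : xtl = D *ᵥ xl)
    (vt mt : Fin d → ℝ) (hvt : vt = xtl - xtj) (hmt : mt = (xtj + xtl) / 2)
    (c : ℝ) (hc : c = vt ⬝ᵥ ((M * D * A₀⁻¹ * Dᵀ * M) *ᵥ vt)) (hc0 : c ≠ 0)
    (xmin : Fin p → ℝ)
    (hxmin : xmin = xi + (((mt - xti) ⬝ᵥ (M *ᵥ vt)) / c) • (A₀⁻¹ *ᵥ (Dᵀ *ᵥ (M *ᵥ vt)))) :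
    (D *ᵥ xmin - mt) ⬝ᵥ (M *ᵥ vt) = 0 ∧
      ∀ x' : Fin p → ℝ, (D *ᵥ x' - mt) ⬝ᵥ (M *ᵥ vt) = 0 →
        (xmin - xi) ⬝ᵥ (A₀ *ᵥ (xmin - xi)) ≤ (x' - xi) ⬝ᵥ (A₀ *ᵥ (x' - xi)) := by
  have hD (x : Fin p → ℝ) :
      (D *ᵥ x) ⬝ᵥ (M *ᵥ vt) = x ⬝ᵥ (Dᵀ *ᵥ (M *ᵥ vt)) := by
    rw [dotProduct_comm, dotProduct_mulVec, ← mulVec_transpose, dotProduct_comm]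
  have hMT : Mᵀ = M := by simpa using hM.isHermitian.eq
  have hcq : c = (A₀⁻¹ *ᵥ (Dᵀ *ᵥ (M *ᵥ vt))) ⬝ᵥ (Dᵀ *ᵥ (M *ᵥ vt)) := by
    rw [← hD, hc]
    simp only [← mulVec_mulVec]
    rw [dotProduct_mulVec, ← mulVec_transpose, hMT, dotProduct_comm]
  have hdet : IsUnit A₀.det := hA₀.det_pos.ne'.isUnit
  have hinv (q : Fin p → ℝ) : A₀ *ᵥ (A₀⁻¹ *ᵥ q) = q := by
    rw [mulVec_mulVec, mul_nonsing_inv _ hdet, one_mulVec]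
  have hmin : (D *ᵥ xmin - mt) ⬝ᵥ (M *ᵥ vt) = 0 := by
    rw [sub_dotProduct, hD, hxmin, add_dotProduct, smul_dotProduct, ← hcq, smul_eq_mul,
      div_mul_cancel₀ _ hc0, sub_dotProduct, hxti, hD]
    ring
  refine ⟨hmin, fun x' hx' => hA₀.posSemidef.dotProduct_mulVec_le_of_eq ?_⟩
  have hA : A₀ *ᵥ (xmin - xi) =
      (((mt - xti) ⬝ᵥ (M *ᵥ vt)) / c) • (Dᵀ *ᵥ (M *ᵥ vt)) := by
    rw [hxmin, add_sub_cancel_left, mulVec_smul, hinv]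
  rw [sub_dotProduct, hD] at hmin hx'
  rw [hA, dotProduct_smul, dotProduct_smul, sub_dotProduct x', sub_dotProduct xmin]
  congr 1
  linarith
end

section
/- Let D be a real d×p matrix, M a positive semidefinite real d×d matrix, and A₀ a positive definite real p×p matrix. Let x_i, x_j, x_l ∈ ℝᵖ and write x̃ = D x for each of them. Set ṽ = x̃_l − x̃_j, m̃ = (x̃_j + x̃_l)/2, assume c := ṽᵀ M D A₀⁻¹ Dᵀ M ṽ ≠ 0, and let x_min^PCA = x_i + (((m̃ − x̃_i)ᵀ M ṽ)/c) · (A₀⁻¹ Dᵀ M ṽ). Then (x_i − x_min^PCA)ᵀ A₀ (x_i − x_min^PCA) = (d²_M(x̃_i, x̃_l) − d²_M(x̃_i, x̃_j))² / (4 · ṽᵀ M D A₀⁻¹ Dᵀ M ṽ). -/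
open Matrix

/-- For symmetric `M`, the difference of two squared `M`-distances from `a` is linear in `a`. -/
theorem Matrix.IsSymm.mahalanobis_sub {n : Type*} [Fintype n] {M : Matrix n n ℝ}
    (hM : M.IsSymm) (a u w : n → ℝ) :
    (a - w) ⬝ᵥ (M *ᵥ (a - w)) - (a - u) ⬝ᵥ (M *ᵥ (a - u)) =
      2 * (((u + w) / 2 - a) ⬝ᵥ (M *ᵥ (w - u))) := by
  have comm (x y : n → ℝ) : x ⬝ᵥ (M *ᵥ y) = y ⬝ᵥ (M *ᵥ x) := by
    rw [dotProduct_mulVec, ← mulVec_transpose, hM.eq, dotProduct_comm]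
  have half : (u + w) / 2 = (2⁻¹ : ℝ) • (u + w) := by
    ext i
    simp [div_eq_inv_mul]
  rw [half]
  simp only [mulVec_sub, dotProduct_sub, sub_dotProduct, add_dotProduct, smul_dotProduct,
    smul_eq_mul]
  rw [comm w a, comm u a, comm w u]
  ring

/-- Dimensionality-reduction (PCA) case: the minimal ellipsoidal squared distance from `x_i`
to the decision boundary equals
`(d²_M(x̃_i,x̃_l) − d²_M(x̃_i,x̃_j))² / (4 ṽᵀ M D A₀⁻¹ Dᵀ M ṽ)`. -/
theorem pca_adversarial_margin_formula {d p : ℕ}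
    (D : Matrix (Fin d) (Fin p) ℝ)
    (M : Matrix (Fin d) (Fin d) ℝ) (hM : M.PosSemidef)
    (A₀ : Matrix (Fin p) (Fin p) ℝ) (hA₀ : A₀.PosDef)
    (xi xj xl : Fin p → ℝ)
    (xti xtj xtl : Fin d → ℝ)
    (hxti : xti = D *ᵥ xi) (hxtj : xtj = D *ᵥ xj) (hxtl : xtl = D *ᵥ xl)
    (vt mt : Fin d → ℝ) (hvt : vt = xtl - xtj) (hmt : mt = (xtj + xtl) / 2)
    (c : ℝ) (hc : c = vt ⬝ᵥ ((M * D * A₀⁻¹ * Dᵀ * M) *ᵥ vt)) (hc0 : c ≠ 0)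
    (xmin : Fin p → ℝ)
    (hxmin : xmin = xi + (((mt - xti) ⬝ᵥ (M *ᵥ vt)) / c) • (A₀⁻¹ *ᵥ (Dᵀ *ᵥ (M *ᵥ vt)))) :
    (xi - xmin) ⬝ᵥ (A₀ *ᵥ (xi - xmin)) =
      ((xti - xtl) ⬝ᵥ (M *ᵥ (xti - xtl)) - (xti - xtj) ⬝ᵥ (M *ᵥ (xti - xtj))) ^ 2
        / (4 * (vt ⬝ᵥ ((M * D * A₀⁻¹ * Dᵀ * M) *ᵥ vt))) := by
  have hMs : M.IsSymm := isHermitian_iff_isSymm.mp hM.isHermitian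
  have hdist := hMs.mahalanobis_sub xti xtj xtl
  rw [← hmt, ← hvt] at hdist
  rw [hdist, ← hc]
  set w := Dᵀ *ᵥ (M *ᵥ vt) with hw
  have hcw : c = (A₀⁻¹ *ᵥ w) ⬝ᵥ w := by
    rw [hc, dotProduct_comm (A₀⁻¹ *ᵥ w), hw]
    simp only [← mulVec_mulVec]
    rw [dotProduct_mulVec vt M, ← mulVec_transpose, hMs.eq, dotProduct_mulVec _ D,
      ← mulVec_transpose]
  have hAw : A₀ *ᵥ (A₀⁻¹ *ᵥ w) = w := by
    rw [mulVec_mulVec, mul_nonsing_inv _ ((isUnit_iff_isUnit_det _).mp hA₀.isUnit), one_mulVec]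
  have hdiff : xi - xmin =
      -((((mt - xti) ⬝ᵥ (M *ᵥ vt)) / c) • (A₀⁻¹ *ᵥ w)) := by
    rw [hxmin, sub_add_cancel_left]
  rw [hdiff, mulVec_neg, neg_dotProduct_neg, mulVec_smul, hAw, smul_dotProduct, dotProduct_smul,
    ← hcw, smul_eq_mul, smul_eq_mul]
  field_simp
  ring
end
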